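/- arXiv:2303.14454 — 6 statements merged into one kernel-verified Lean document; each statement's English description precedes it below -/
import Mathlib

section
/- In the unweighted setting, under binary XOS valuations, MNW is not resource-monotone regardless of tie-breaking: there exist a finite set of goods G, a good g* ∈ G, agents with binary XOS valuations on G (whose restrictions to G ∖ {g*} are also binary XOS), and an agent i, such that for every MNW allocation A of the instance with goods G ∖ {g*} and every MNW allocation A' of the instance with goods G, we have v_i(A'_i) < v_i(A_i). -/
open Finset

/-- An allocation of (some of) the goods in `M` to `n` agents: pairwise disjoint bundles. -/
def IsAlloc (n : ℕ) (M : Finset ℕ) (A : Fin n → Finset ℕ) : Prop :=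
  (∀ i, A i ⊆ M) ∧ ∀ i j : Fin n, i ≠ j → Disjoint (A i) (A j)

/-- A (real-valued) valuation on the goods in `M`: normalized and nonnegative. -/
def ValuationOn (M : Finset ℕ) (v : Finset ℕ → ℝ) : Prop :=
  v ∅ = 0 ∧ ∀ S ⊆ M, 0 ≤ v S

/-- Binary valuation: every marginal gain is `0` or `1`. -/
def BinaryOn (M : Finset ℕ) (v : Finset ℕ → ℝ) : Prop :=
  ∀ S ⊆ M, ∀ g ∈ M, g ∉ S → v (insert g S) = v S ∨ v (insert g S) = v S + 1

/-- XOS valuation: the pointwise maximum of a finite nonempty family of additive valuations. -/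
def XOSOn (M : Finset ℕ) (v : Finset ℕ → ℝ) : Prop :=
  ∃ (k : ℕ) (h : Fin (k + 1) → ℕ → ℝ),
    (∀ j g, 0 ≤ h j g) ∧
    ∀ S ⊆ M, v S = Finset.univ.sup' Finset.univ_nonempty fun j => ∑ g ∈ S, h j g

/-- Binary XOS valuation. -/
def BinaryXOSOn (M : Finset ℕ) (v : Finset ℕ → ℝ) : Prop :=
  ValuationOn M v ∧ BinaryOn M v ∧ XOSOn M v

/-- Subadditive valuation. -/
def SubadditiveOn (M : Finset ℕ) (v : Finset ℕ → ℝ) : Prop :=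
  ∀ S T : Finset ℕ, S ⊆ M → T ⊆ M → v (S ∪ T) ≤ v S + v T

/-- Binary subadditive valuation. -/
def BinarySubadditiveOn (M : Finset ℕ) (v : Finset ℕ → ℝ) : Prop :=
  ValuationOn M v ∧ BinaryOn M v ∧ SubadditiveOn M v

/-- Additive valuation with nonnegative values. -/
def AdditiveOn (M : Finset ℕ) (v : Finset ℕ → ℝ) : Prop :=
  (∀ g ∈ M, 0 ≤ v {g}) ∧ ∀ S ⊆ M, v S = ∑ g ∈ S, v {g}

/-- Restricted additive (generalized binary) profile: each agent's value for each good
is `0` or a common good-dependent value `h g`. -/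
def RestrictedAdditive (n : ℕ) (M : Finset ℕ) (v : Fin n → Finset ℕ → ℝ) : Prop :=
  (∀ i, AdditiveOn M (v i)) ∧
  ∃ h : ℕ → ℝ, (∀ g ∈ M, 0 ≤ h g) ∧ ∀ i, ∀ g ∈ M, v i {g} = 0 ∨ v i {g} = h g

/-- The Nash welfare (product of utilities) of an allocation. -/
def NashProd (n : ℕ) (v : Fin n → Finset ℕ → ℝ) (A : Fin n → Finset ℕ) : ℝ :=
  ∏ i, v i (A i)

/-- The set of agents receiving positive utility. -/
noncomputable def PosAgentsR (n : ℕ) (v : Fin n → Finset ℕ → ℝ) (A : Fin n → Finset ℕ) :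
    Finset (Fin n) :=
  Finset.univ.filter fun i => 0 < v i (A i)

/-- The product of the positive utilities. -/
noncomputable def PosProd (n : ℕ) (v : Fin n → Finset ℕ → ℝ) (A : Fin n → Finset ℕ) : ℝ :=
  ∏ i ∈ PosAgentsR n v A, v i (A i)

/-- `A` is a maximum Nash welfare (MNW) allocation: it maximizes the product of utilities;
if the maximum product is `0`, it first maximizes the number of positively-served agents and
then the product of the positive utilities. -/
def IsMNW (n : ℕ) (M : Finset ℕ) (v : Fin n → Finset ℕ → ℝ) (A : Fin n → Finset ℕ) : Prop :=
  IsAlloc n M A ∧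
  ((∃ B, IsAlloc n M B ∧ NashProd n v B ≠ 0) →
    ∀ B, IsAlloc n M B → NashProd n v B ≤ NashProd n v A) ∧
  ((∀ B, IsAlloc n M B → NashProd n v B = 0) →
    ∀ B, IsAlloc n M B →
      (PosAgentsR n v B).card ≤ (PosAgentsR n v A).card ∧
      ((PosAgentsR n v B).card = (PosAgentsR n v A).card →
        PosProd n v B ≤ PosProd n v A))

/-- The maximum of two binary additive valuations. -/
noncomputable def maxVal (P Q : Finset ℕ) (S : Finset ℕ) : ℝ :=
  max ((S ∩ P).card : ℝ) ((S ∩ Q).card : ℝ)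

lemma card_insert_inter (P S : Finset ℕ) (g : ℕ) (hg : g ∉ S) :
    (insert g S ∩ P).card = (S ∩ P).card + if g ∈ P then 1 else 0 := by
  split_ifs with h
  · rw [Finset.insert_inter_of_mem h, Finset.card_insert_of_notMem]
    simp [hg]
  · rw [Finset.insert_inter_of_notMem h]; simp

lemma maxVal_binaryXOS (M P Q : Finset ℕ) : BinaryXOSOn M (maxVal P Q) := by
  refine ⟨⟨by simp [maxVal], fun S _ => by simp [maxVal]⟩, ?_, ?_⟩
  · intro S _ g _ hg
    unfold maxVal
    rw [card_insert_inter P S g hg, card_insert_inter Q S g hg]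
    norm_cast
    split_ifs <;> omega
  · refine ⟨1, fun j g => if j = 0 then (if g ∈ P then 1 else 0) else (if g ∈ Q then 1 else 0),
      ?_, ?_⟩
    · intro j g
      dsimp only
      split_ifs <;> norm_num
    · intro S _
      apply le_antisymm
      · apply max_le
        · refine le_trans (le_of_eq ?_) (Finset.le_sup' _ (Finset.mem_univ (0 : Fin 2)))
          simp
        · refine le_trans (le_of_eq ?_) (Finset.le_sup' _ (Finset.mem_univ (1 : Fin 2)))
          simp
      · apply Finset.sup'_le
        intro j _
        fin_cases j <;> simp [maxVal]

/-- Under binary XOS valuations, MNW is not resource-monotone regardless of tie-breaking: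
removing a good `g*` can strictly increase some agent's utility under every MNW allocation. -/
theorem mnwNotResourceMonotoneXOS :
    ∃ (M : Finset ℕ) (gstar : ℕ) (n : ℕ) (v : Fin n → Finset ℕ → ℝ) (i : Fin n),
      gstar ∈ M ∧
      (∀ j, BinaryXOSOn M (v j)) ∧
      (∀ j, BinaryXOSOn (M.erase gstar) (v j)) ∧
      ∀ A A' : Fin n → Finset ℕ,
        IsMNW n (M.erase gstar) v A → IsMNW n M v A' →
        v i (A' i) < v i (A i) := by
  refine ⟨{0, 1, 2, 3, 4}, 4, 2, ![maxVal {0, 1, 2} {0, 1, 2}, maxVal {3} {0, 4}], 0, by simp,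
    ?_, ?_, ?_⟩
  · intro j; fin_cases j <;> exact maxVal_binaryXOS _ _ _
  · intro j; fin_cases j <;> exact maxVal_binaryXOS _ _ _
  intro A A' hA hA'
  obtain ⟨⟨hs, hd⟩, hm, -⟩ := hA
  obtain ⟨⟨hs', hd'⟩, hm', -⟩ := hA'
  have e1 : ({0, 1, 2} : Finset ℕ) ∩ {0, 1, 2} = {0, 1, 2} := by decide
  have e2 : ({3} : Finset ℕ) ∩ {3} = {3} := by decide
  have e3 : ({3} : Finset ℕ) ∩ {0, 4} = ∅ := by decide
  have f1 : ({1, 2} : Finset ℕ) ∩ {0, 1, 2} = {1, 2} := by decide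
  have f2 : ({0, 4} : Finset ℕ) ∩ {3} = ∅ := by decide
  have f3 : ({0, 4} : Finset ℕ) ∩ {0, 4} = {0, 4} := by decide
  have aB : IsAlloc 2 (Finset.erase {0, 1, 2, 3, 4} 4) ![{0, 1, 2}, {3}] := by
    unfold IsAlloc; decide
  have aB' : IsAlloc 2 {0, 1, 2, 3, 4} ![{1, 2}, {0, 4}] := by
    unfold IsAlloc; decide
  have pB : NashProd 2 ![maxVal {0, 1, 2} {0, 1, 2}, maxVal {3} {0, 4}] ![{0, 1, 2}, {3}] = 3 := by
    simp [NashProd, maxVal, e1, e2, e3]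
  have pB' : NashProd 2 ![maxVal {0, 1, 2} {0, 1, 2}, maxVal {3} {0, 4}] ![{1, 2}, {0, 4}] = 4 := by
    simp [NashProd, maxVal, f1, f2, f3]; norm_num
  have h := hm ⟨_, aB, by rw [pB]; norm_num⟩ _ aB
  have h' := hm' ⟨_, aB', by rw [pB']; norm_num⟩ _ aB'
  rw [pB] at h
  rw [pB'] at h'
  have d' : Disjoint (A' 0) (A' 1) := hd' 0 1 (by decide)
  have hs1 := hs 1
  simp only [NashProd, Fin.prod_univ_two, Matrix.cons_val_zero, Matrix.cons_val_one] at h h' ⊢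
  -- without the extra good, the second agent has value at most one
  have u : maxVal {3} {0, 4} (A 1) ≤ 1 := by
    have k1 : (A 1 ∩ {3}).card ≤ 1 := Finset.card_le_card (Finset.inter_subset_right)
    have k2 : (A 1 ∩ {0, 4}).card ≤ 1 := by
      refine Finset.card_le_card (t := {0}) ?_
      intro x hx
      have := hs1 (Finset.mem_inter.1 hx).1
      have h2 := (Finset.mem_inter.1 hx).2
      simp at this h2 ⊢
      omega
    unfold maxVal
    exact max_le (by exact_mod_cast k1) (by exact_mod_cast k2)
  have nn : 0 ≤ maxVal {0, 1, 2} {0, 1, 2} (A 0) := by simp [maxVal]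
  have l : 3 ≤ maxVal {0, 1, 2} {0, 1, 2} (A 0) := by nlinarith
  refine lt_of_lt_of_le ?_ l
  by_contra hc
  have hc3 : 3 ≤ (A' 0 ∩ {0, 1, 2}).card := by
    simp only [maxVal, max_self, not_lt] at hc
    exact_mod_cast hc
  have heq : A' 0 ∩ {0, 1, 2} = {0, 1, 2} :=
    Finset.eq_of_subset_of_card_le Finset.inter_subset_right (by simpa using hc3)
  have h0 : 0 ∈ A' 0 := (Finset.mem_inter.1 (heq ▸ (by simp : (0 : ℕ) ∈ ({0, 1, 2} : Finset ℕ)))).1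
  have h01 : 0 ∉ A' 1 := Finset.disjoint_left.1 d' h0
  have u' : maxVal {3} {0, 4} (A' 1) ≤ 1 := by
    have k1 : (A' 1 ∩ {3}).card ≤ 1 := Finset.card_le_card (Finset.inter_subset_right)
    have k2 : (A' 1 ∩ {0, 4}).card ≤ 1 := by
      refine Finset.card_le_card (t := {4}) ?_
      intro x hx
      have h1 := (Finset.mem_inter.1 hx).1
      have h2 := (Finset.mem_inter.1 hx).2
      simp at h2 ⊢
      rcases h2 with rfl | rfl
      · exact absurd h1 h01
      · rfl
    unfold maxVal
    exact max_le (by exact_mod_cast k1) (by exact_mod_cast k2)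
  have w : maxVal {0, 1, 2} {0, 1, 2} (A' 0) = 3 := by
    simp [maxVal, heq]
  rw [w] at h'
  linarith
end

section
/- In the unweighted setting, under binary XOS valuations, MNW is not population-monotone regardless of tie-breaking: there exist a finite set of goods G, agents N with binary XOS valuations on G, an additional agent with a binary XOS valuation on G, and an agent i ∈ N, such that for every MNW allocation A of the instance with agent set N and every MNW allocation A' of the instance with agent set N plus the additional agent (the agents in N keeping their valuations), we have v_i(A'_i) > v_i(A_i). -/
open Finset

/-- The maximum of two `0/1` additive clauses, supported on `T` and `U`. -/
def clauseVal (T U S : Finset ℕ) : ℕ := max (S ∩ T).card (S ∩ U).card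

lemma card_inter_insert (T S : Finset ℕ) (g : ℕ) (hg : g ∉ S) :
    (insert g S ∩ T).card = (S ∩ T).card + if g ∈ T then 1 else 0 := by
  split_ifs with h
  · rw [Finset.insert_inter_of_mem h, Finset.card_insert_of_notMem]
    simp [hg]
  · rw [Finset.insert_inter_of_notMem h]; rfl

lemma clauseVal_binaryXOS (M T U : Finset ℕ) :
    BinaryXOSOn M (fun S => (clauseVal T U S : ℝ)) := by
  refine ⟨⟨by simp [clauseVal], fun S _ => Nat.cast_nonneg _⟩, ?_, ?_⟩
  · intro S _ g _ hgS
    have h : clauseVal T U (insert g S) = clauseVal T U S ∨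
        clauseVal T U (insert g S) = clauseVal T U S + 1 := by
      unfold clauseVal
      rw [card_inter_insert T S g hgS, card_inter_insert U S g hgS]
      split_ifs <;> omega
    dsimp only
    exact_mod_cast h
  · refine ⟨1, fun j g => if g ∈ (if j = 0 then T else U) then 1 else 0, ?_, ?_⟩
    · intro j g
      dsimp only
      positivity
    · intro S _
      have hs : ∀ j : Fin 2, (∑ g ∈ S, if g ∈ (if j = 0 then T else U) then (1 : ℝ) else 0)
          = ((S ∩ (if j = 0 then T else U)).card : ℝ) := by
        intro j
        rw [← Finset.sum_filter, Finset.sum_const, nsmul_eq_mul, mul_one,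
          Finset.filter_mem_eq_inter]
      simp only [hs]
      apply le_antisymm
      · simp only [clauseVal, Nat.cast_max]
        apply max_le
        · exact Finset.le_sup' (fun j : Fin 2 => ((S ∩ (if j = 0 then T else U)).card : ℝ))
            (Finset.mem_univ 0)
        · exact Finset.le_sup' (fun j : Fin 2 => ((S ∩ (if j = 0 then T else U)).card : ℝ))
            (Finset.mem_univ 1)
      · apply Finset.sup'_le
        intro j _
        simp only [clauseVal, Nat.cast_max]
        fin_cases j <;> simp

/-- The three agents: the third one is the additional agent. -/
def exVal : Fin 3 → Finset ℕ → ℕ :=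
  ![clauseVal {1, 2, 3} ∅, clauseVal {0, 1} {4}, clauseVal {0} ∅]

lemma card_inter_eq (S : Finset ℕ) (T : Finset ℕ) :
    (S ∩ T).card = ∑ g ∈ T, if g ∈ S then 1 else 0 := by
  rw [Finset.inter_comm, ← Finset.filter_mem_eq_inter, Finset.card_filter]

lemma exVal_zero (S : Finset ℕ) : exVal 0 S =
    (if 1 ∈ S then 1 else 0) + (if 2 ∈ S then 1 else 0) + (if 3 ∈ S then 1 else 0) := by
  have h : exVal 0 S = max (S ∩ {1, 2, 3}).card (S ∩ ∅).card := rfl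
  rw [h, card_inter_eq, Finset.inter_empty, Finset.card_empty, Finset.sum_insert (by decide),
    Finset.sum_insert (by decide), Finset.sum_singleton]
  omega

lemma exVal_one (S : Finset ℕ) : exVal 1 S =
    max ((if 0 ∈ S then 1 else 0) + (if 1 ∈ S then 1 else 0)) (if 4 ∈ S then 1 else 0) := by
  have h : exVal 1 S = max (S ∩ {0, 1}).card (S ∩ {4}).card := rfl
  rw [h, card_inter_eq, card_inter_eq, Finset.sum_insert (by decide), Finset.sum_singleton,
    Finset.sum_singleton]

lemma exVal_two (S : Finset ℕ) : exVal 2 S = if 0 ∈ S then 1 else 0 := by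
  simp [exVal, clauseVal, card_inter_eq]

/-- Under binary XOS valuations, MNW is not population-monotone regardless of tie-breaking:
adding an extra agent can strictly increase some original agent's utility under every MNW
allocation. -/
theorem mnwNotPopulationMonotoneXOS :
    ∃ (M : Finset ℕ) (n : ℕ) (v : Fin (n + 1) → Finset ℕ → ℝ) (i : Fin n),
      (∀ j, BinaryXOSOn M (v j)) ∧
      ∀ (A : Fin n → Finset ℕ) (A' : Fin (n + 1) → Finset ℕ),
        IsMNW n M (fun j => v j.castSucc) A → IsMNW (n + 1) M v A' →
        v i.castSucc (A i) < v i.castSucc (A' i.castSucc) := by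
  refine ⟨{0, 1, 2, 3, 4}, 2, fun j S => (exVal j S : ℝ), 0, ?_, ?_⟩
  · intro j
    fin_cases j <;> exact clauseVal_binaryXOS _ _ _
  · intro A A' hA hA'
    have hB : IsAlloc 2 {0, 1, 2, 3, 4} ![{2, 3}, {0, 1}] := by
      unfold IsAlloc; decide
    have hB' : IsAlloc 3 {0, 1, 2, 3, 4} ![{1, 2, 3}, {4}, {0}] := by
      unfold IsAlloc; decide
    have pB : NashProd 2 (fun j S => (exVal j.castSucc S : ℝ)) ![{2, 3}, {0, 1}] = 4 := by
      have e : exVal 0 {2, 3} * exVal 1 {0, 1} = 4 := by decide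
      simp only [NashProd, Fin.prod_univ_two]
      exact_mod_cast e
    have pB' : NashProd 3 (fun j S => (exVal j S : ℝ)) ![{1, 2, 3}, {4}, {0}] = 3 := by
      have e : exVal 0 {1, 2, 3} * exVal 1 {4} * exVal 2 {0} = 3 := by decide
      simp only [NashProd, Fin.prod_univ_three]
      exact_mod_cast e
    have h1 := hA.2.1 ⟨_, hB, by rw [pB]; norm_num⟩ _ hB
    have h2 := hA'.2.1 ⟨_, hB', by rw [pB']; norm_num⟩ _ hB'
    rw [pB] at h1
    rw [pB'] at h2
    simp only [NashProd, Fin.prod_univ_two] at h1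
    have h2 : (3 : ℝ) ≤ ∏ j : Fin 3, (exVal j (A' j) : ℝ) := h2
    rw [Fin.prod_univ_three] at h2
    have k1 : 4 ≤ exVal 0 (A 0) * exVal 1 (A 1) := by exact_mod_cast h1
    have k2 : 3 ≤ exVal 0 (A' 0) * exVal 1 (A' 1) * exVal 2 (A' 2) := by exact_mod_cast h2
    have d1 : ¬ (1 ∈ A 0 ∧ 1 ∈ A 1) := fun h =>
      Finset.disjoint_left.mp (hA.1.2 0 1 (by decide)) h.1 h.2
    have d2 : ¬ (0 ∈ A' 1 ∧ 0 ∈ A' 2) := fun h =>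
      Finset.disjoint_left.mp (hA'.1.2 1 2 (by decide)) h.1 h.2
    have a1 : exVal 0 (A 0) ≤ 2 := by
      by_contra hc
      have b0 : exVal 0 (A 0) ≤ 3 := by rw [exVal_zero]; split_ifs <;> omega
      have m1 : 1 ∈ A 0 := by
        by_contra hm
        apply hc
        rw [exVal_zero, if_neg hm]; split_ifs <;> omega
      have m2 : 1 ∉ A 1 := fun h => d1 ⟨m1, h⟩
      have b1 : exVal 1 (A 1) ≤ 1 := by
        rw [exVal_one, if_neg m2]; split_ifs <;> simp
      nlinarith
    have a2 : 3 ≤ exVal 0 (A' 0) := by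
      have m2 : 0 ∈ A' 2 := by
        by_contra hm
        rw [exVal_two, if_neg hm] at k2
        omega
      have m1 : 0 ∉ A' 1 := fun h => d2 ⟨h, m2⟩
      have b1 : exVal 1 (A' 1) ≤ 1 := by
        rw [exVal_one, if_neg m1]; split_ifs <;> simp
      rw [exVal_two, if_pos m2] at k2
      nlinarith
    have : exVal 0 (A 0) < exVal 0 (A' 0) := by omega
    exact Nat.cast_lt.mpr this
end

section
/- In the unweighted setting, under binary subadditive valuations, MNW fails resource-monotonicity, population-monotonicity, and strategyproofness regardless of tie-breaking. That is: (a) there exist a finite set of goods G, a good g* ∈ G, agents with binary subadditive valuations on G, and an agent i such that every MNW allocation A of the instance with goods G ∖ {g*} and every MNW allocation A' of the instance with goods G satisfy v_i(A'_i) < v_i(A_i); (b) there exist an instance with binary subadditive valuations, an additional agent with a binary subadditive valuation, and an original agent i such that every MNW allocation of the original instance gives i strictly greater utility than every MNW allocation of the instance with the additional agent gives i... (correctly: strictly less after adding the agent is violated, i.e., v_i(A'_i) > v_i(A_i) for all such A, A'); and (c) there exist a binary subadditive profile, an agent i, and a binary subadditive false valuation v'_i such that every MNW allocation under the true profile gives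 i strictly less true utility than every MNW allocation under the misreported profile. -/
open Finset

/-- A valuation depending only on the numbers of goods from `X` and from `Y`. -/
noncomputable def cval (X Y : Finset ℕ) (f : ℕ → ℕ → ℕ) (S : Finset ℕ) : ℝ :=
  ((f (S ∩ X).card (S ∩ Y).card : ℕ) : ℝ)

theorem card_insert_inter_cases (X S : Finset ℕ) (g : ℕ) (hg : g ∉ S) :
    (g ∉ X ∧ (insert g S ∩ X).card = (S ∩ X).card) ∨
    (g ∈ X ∧ (insert g S ∩ X).card = (S ∩ X).card + 1 ∧ (S ∩ X).card < X.card) := by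
  by_cases h : g ∈ X
  · right
    have h1 : (insert g S ∩ X).card = (S ∩ X).card + 1 := by
      rw [Finset.insert_inter_of_mem h, Finset.card_insert_of_notMem]
      simp [hg]
    have h2 := Finset.card_le_card (Finset.inter_subset_right : insert g S ∩ X ⊆ X)
    exact ⟨h, h1, by omega⟩
  · left
    rw [Finset.insert_inter_of_notMem h]
    exact ⟨h, rfl⟩

theorem card_union_inter_le (X S T : Finset ℕ) :
    ((S ∪ T) ∩ X).card ≤ min X.card ((S ∩ X).card + (T ∩ X).card) := by
  refine le_min (Finset.card_le_card Finset.inter_subset_right) ?_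
  rw [Finset.union_inter_distrib_right]
  exact Finset.card_union_le _ _

theorem cval_binarySubadditive (M X Y : Finset ℕ) (f : ℕ → ℕ → ℕ) (hXY : Disjoint X Y)
    (h0 : f 0 0 = 0)
    (hx : ∀ a < X.card, ∀ b < Y.card + 1, f (a + 1) b = f a b ∨ f (a + 1) b = f a b + 1)
    (hy : ∀ a < X.card + 1, ∀ b < Y.card, f a (b + 1) = f a b ∨ f a (b + 1) = f a b + 1)
    (hs : ∀ a < X.card + 1, ∀ b < Y.card + 1, ∀ c < X.card + 1, ∀ d < Y.card + 1,
      ∀ p < min X.card (a + c) + 1, ∀ q < min Y.card (b + d) + 1,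
      f p q ≤ f a b + f c d) :
    BinarySubadditiveOn M (cval X Y f) := by
  have hcX : ∀ S : Finset ℕ, (S ∩ X).card < X.card + 1 := fun S =>
    Nat.lt_succ_of_le (Finset.card_le_card Finset.inter_subset_right)
  have hcY : ∀ S : Finset ℕ, (S ∩ Y).card < Y.card + 1 := fun S =>
    Nat.lt_succ_of_le (Finset.card_le_card Finset.inter_subset_right)
  refine ⟨⟨by simp [cval, h0], fun S _ => by unfold cval; positivity⟩, ?_, ?_⟩
  · intro S _ g _ hg
    unfold cval
    rcases card_insert_inter_cases X S g hg with ⟨h1, h2⟩ | ⟨h1, h2, h3⟩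
    · rcases card_insert_inter_cases Y S g hg with ⟨k1, k2⟩ | ⟨k1, k2, k3⟩
      · left; rw [h2, k2]
      · rw [h2, k2]
        exact_mod_cast hy _ (hcX S) _ k3
    · rcases card_insert_inter_cases Y S g hg with ⟨k1, k2⟩ | ⟨k1, k2, k3⟩
      · rw [h2, k2]
        exact_mod_cast hx _ h3 _ (hcY S)
      · exact absurd k1 (Finset.disjoint_left.mp hXY h1)
  · intro S T _ _
    unfold cval
    exact_mod_cast hs _ (hcX S) _ (hcY S) _ (hcX T) _ (hcY T) _
      (Nat.lt_succ_of_le (card_union_inter_le X S T)) _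
      (Nat.lt_succ_of_le (card_union_inter_le Y S T))

/-- Additive. -/
def fAdd (a b : ℕ) : ℕ := a + b
/-- Unit demand. -/
def fUnit (a _b : ℕ) : ℕ := min a 1
/-- Value one for anything, and one more for both goods of the first type. -/
def fPair (a b : ℕ) : ℕ := min (a + b) 1 + (if 2 ≤ a then 1 else 0)
/-- The misreport. -/
def fLie (a b : ℕ) : ℕ :=
  if 2 ≤ a then (if 3 ≤ b then 3 else 2)
  else if 3 ≤ a + b ∧ 1 ≤ a then 2 else min (a + b) 1

theorem fPair_le (a b : ℕ) : fPair a b ≤ 2 := by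
  unfold fPair; split <;> omega

theorem fPair_two (a b : ℕ) (h : 2 ≤ fPair a b) : 2 ≤ a := by
  unfold fPair at h; split at h <;> omega

theorem subset_of_card_inter (X S : Finset ℕ) (h : X.card ≤ (S ∩ X).card) : X ⊆ S := by
  have := Finset.eq_of_subset_of_card_le (Finset.inter_subset_right : S ∩ X ⊆ X) h
  exact Finset.inter_eq_right.mp this

theorem bs_add (M X Y : Finset ℕ) (h : Disjoint X Y) :
    BinarySubadditiveOn M (cval X Y fAdd) := by
  apply cval_binarySubadditive _ _ _ _ h rfl <;> unfold fAdd <;> intros <;> omega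

theorem bs_unit (M X : Finset ℕ) : BinarySubadditiveOn M (cval X ∅ fUnit) := by
  apply cval_binarySubadditive _ _ _ _ (by simp) rfl <;> unfold fUnit <;> intros <;> omega

theorem bs_pair (M X Y : Finset ℕ) (h : Disjoint X Y) (hX : X.card = 2) (hY : Y.card = 1) :
    BinarySubadditiveOn M (cval X Y fPair) := by
  apply cval_binarySubadditive _ _ _ _ h rfl <;> rw [hX, hY] <;> decide

theorem bs_lie (M X Y : Finset ℕ) (h : Disjoint X Y) (hX : X.card = 2) (hY : Y.card = 3) :
    BinarySubadditiveOn M (cval X Y fLie) := by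
  apply cval_binarySubadditive _ _ _ _ h rfl <;> rw [hX, hY] <;> decide

theorem IsMNW.le {n : ℕ} {M : Finset ℕ} {v : Fin n → Finset ℕ → ℝ} {A : Fin n → Finset ℕ}
    (hA : IsMNW n M v A) (B : Fin n → Finset ℕ) (hB : IsAlloc n M B) (c : ℕ) (hc : 0 < c)
    (h : NashProd n v B = c) : (c : ℝ) ≤ NashProd n v A := by
  rw [← h]
  refine hA.2.1 ⟨B, hB, ?_⟩ B hB
  rw [h]; exact_mod_cast hc.ne'

/-- If `j` holds good `3`, the pair agent has value at most `1`. -/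
theorem pair_le_one (X Y S : Finset ℕ) (t : ℕ) (hX : X.card = 2) (ht : t ∈ X) (hS : t ∉ S) :
    fPair (S ∩ X).card (S ∩ Y).card ≤ 1 := by
  by_contra hcon
  have h1 := fPair_two _ _ (by omega : 2 ≤ fPair (S ∩ X).card (S ∩ Y).card)
  exact hS (subset_of_card_inter X S (by omega) ht)

theorem card_inter_le_of_forall (S X Z : Finset ℕ) (h : ∀ t ∈ X, t ∉ Z → t ∉ S) :
    (S ∩ X).card ≤ Z.card := by
  apply Finset.card_le_card
  intro t ht
  rw [Finset.mem_inter] at ht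
  by_contra hz
  exact h t ht.2 hz ht.1

theorem mem_of_unit (S M X : Finset ℕ) (t : ℕ) (hS : S ⊆ M) (hM : ∀ u ∈ X, u ∈ M → u = t)
    (h : 0 < fUnit (S ∩ X).card (S ∩ ∅).card) : t ∈ S := by
  have h1 : 0 < (S ∩ X).card := by unfold fUnit at h; omega
  obtain ⟨u, hu⟩ := Finset.card_pos.mp h1
  rw [Finset.mem_inter] at hu
  rw [← hM u hu.2 (hS hu.1)]
  exact hu.1

theorem pair_conflict (S T X Y : Finset ℕ) (h : Disjoint S T)
    (h2 : 2 ≤ fPair (T ∩ X).card (T ∩ Y).card) (hX : X.card = 2) : ∀ t ∈ X, t ∉ S := by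
  intro t ht hs
  have := subset_of_card_inter X T (by rw [hX]; exact fPair_two _ _ h2) ht
  exact Finset.disjoint_left.mp h hs this

theorem card_inter_le_right (S X : Finset ℕ) : (S ∩ X).card ≤ X.card :=
  Finset.card_le_card Finset.inter_subset_right

theorem partA : ∃ (M : Finset ℕ) (gstar : ℕ) (n : ℕ) (v : Fin n → Finset ℕ → ℝ) (i : Fin n),
      gstar ∈ M ∧ (∀ j, BinarySubadditiveOn M (v j)) ∧
      ∀ A A' : Fin n → Finset ℕ,
        IsMNW n (M.erase gstar) v A → IsMNW n M v A' →
        v i (A' i) < v i (A i) := by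
  refine ⟨{0, 1, 2, 3, 4, 5}, 5, 3,
    ![cval {0, 1, 2} ∅ fAdd, cval {0, 3} {4} fPair, cval {3, 5} ∅ fUnit], 0, by decide, ?_, ?_⟩
  · intro j
    fin_cases j
    · exact bs_add _ _ _ (by simp)
    · exact bs_pair _ _ _ (by decide) (by decide) (by decide)
    · exact bs_unit _ _
  · intro A A' hA hA'
    have h1 := hA.le ![{0, 1, 2}, {4}, {3}] (by unfold IsAlloc; decide) 3 (by norm_num) (by
      simp only [NashProd, Fin.prod_univ_three]
      change cval _ _ _ _ * cval _ _ _ _ * cval _ _ _ _ = _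
      unfold cval
      exact_mod_cast (by decide))
    have h2 := hA'.le ![{1, 2}, {0, 3}, {5}] (by unfold IsAlloc; decide) 4 (by norm_num) (by
      simp only [NashProd, Fin.prod_univ_three]
      change cval _ _ _ _ * cval _ _ _ _ * cval _ _ _ _ = _
      unfold cval
      exact_mod_cast (by decide))
    simp only [NashProd, Fin.prod_univ_three] at h1 h2
    change ((3 : ℕ) : ℝ) ≤ cval _ _ _ _ * cval _ _ _ _ * cval _ _ _ _ at h1
    change ((4 : ℕ) : ℝ) ≤ cval _ _ _ _ * cval _ _ _ _ * cval _ _ _ _ at h2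
    change cval _ _ _ _ < cval _ _ _ _
    unfold cval at h1 h2 ⊢
    norm_cast at h1 h2 ⊢
    have u1 : fUnit (A 2 ∩ {3, 5}).card (A 2 ∩ ∅).card ≤ 1 := min_le_right _ _
    have u2 : fUnit (A' 2 ∩ {3, 5}).card (A' 2 ∩ ∅).card ≤ 1 := min_le_right _ _
    have m3 : 3 ∈ A 2 := mem_of_unit (A 2) _ {3, 5} 3 (hA.1.1 2) (by decide) (by
      apply Nat.pos_of_ne_zero; intro h; rw [h] at h1; omega)
    have p1 : fPair (A 1 ∩ {0, 3}).card (A 1 ∩ {4}).card ≤ 1 :=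
      pair_le_one _ _ _ 3 (by decide) (by decide) (fun h =>
        Finset.disjoint_left.mp (hA.1.2 1 2 (by decide)) h m3)
    have q1 : 3 ≤ fAdd (A 0 ∩ {0, 1, 2}).card (A 0 ∩ ∅).card := by
      have := Nat.mul_le_mul (Nat.mul_le_mul
        (le_refl (fAdd (A 0 ∩ {0, 1, 2}).card (A 0 ∩ ∅).card)) p1) u1
      omega
    have b2 : fAdd (A' 0 ∩ {0, 1, 2}).card (A' 0 ∩ ∅).card ≤ 3 := by
      have := card_inter_le_right (A' 0) {0, 1, 2}
      simpa [fAdd] using this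
    have p2 : 2 ≤ fPair (A' 1 ∩ {0, 3}).card (A' 1 ∩ {4}).card := by
      by_contra hc
      have := Nat.mul_le_mul (Nat.mul_le_mul b2
        (by omega : fPair (A' 1 ∩ {0, 3}).card (A' 1 ∩ {4}).card ≤ 1)) u2
      omega
    have c := pair_conflict (A' 0) (A' 1) _ _ (hA'.1.2 0 1 (by decide)) p2 (by decide)
    have d := card_inter_le_of_forall (A' 0) {0, 1, 2} {1, 2} (by
      intro t ht hz
      apply c
      revert t; decide)
    have e : fAdd (A' 0 ∩ {0, 1, 2}).card (A' 0 ∩ ∅).card ≤ 2 := by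
      simpa [fAdd] using d
    omega

theorem partB : ∃ (M : Finset ℕ) (n : ℕ) (v : Fin (n + 1) → Finset ℕ → ℝ) (i : Fin n),
      (∀ j, BinarySubadditiveOn M (v j)) ∧
      ∀ (A : Fin n → Finset ℕ) (A' : Fin (n + 1) → Finset ℕ),
        IsMNW n M (fun j => v j.castSucc) A → IsMNW (n + 1) M v A' →
        v i.castSucc (A i) < v i.castSucc (A' i.castSucc) := by
  refine ⟨{0, 1, 2, 3, 4}, 2,
    ![cval {0, 1, 2} ∅ fAdd, cval {0, 3} {4} fPair, cval {3} ∅ fUnit], 0, ?_, ?_⟩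
  · intro j
    fin_cases j
    · exact bs_add _ _ _ (by simp)
    · exact bs_pair _ _ _ (by decide) (by decide) (by decide)
    · exact bs_unit _ _
  · intro A' A hA' hA
    change IsMNW 3 _ _ A at hA
    have h1 := hA.le ![{0, 1, 2}, {4}, {3}] (by unfold IsAlloc; decide) 3 (by norm_num) (by
      simp only [NashProd, Fin.prod_univ_three]
      change cval _ _ _ _ * cval _ _ _ _ * cval _ _ _ _ = _
      unfold cval
      exact_mod_cast (by decide))
    have h2 := hA'.le ![{1, 2}, {0, 3}] (by unfold IsAlloc; decide) 4 (by norm_num) (by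
      simp only [NashProd, Fin.prod_univ_two]
      change cval _ _ _ _ * cval _ _ _ _ = _
      unfold cval
      exact_mod_cast (by decide))
    simp only [NashProd, Fin.prod_univ_three, Fin.prod_univ_two] at h1 h2
    change ((3 : ℕ) : ℝ) ≤ cval {0, 1, 2} ∅ fAdd (A 0) * cval {0, 3} {4} fPair (A 1)
      * cval {3} ∅ fUnit (A 2) at h1
    change ((4 : ℕ) : ℝ) ≤ cval {0, 1, 2} ∅ fAdd (A' 0) * cval {0, 3} {4} fPair (A' 1) at h2
    change cval {0, 1, 2} ∅ fAdd (A' 0) < cval {0, 1, 2} ∅ fAdd (A 0)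
    unfold cval at h1 h2 ⊢
    norm_cast at h1 h2 ⊢
    have u1 : fUnit (A 2 ∩ {3}).card (A 2 ∩ ∅).card ≤ 1 := min_le_right _ _
    have m3 : 3 ∈ A 2 := mem_of_unit (A 2) _ {3} 3 (hA.1.1 2) (by decide) (by
      apply Nat.pos_of_ne_zero; intro h; rw [h] at h1; omega)
    have p1 : fPair (A 1 ∩ {0, 3}).card (A 1 ∩ {4}).card ≤ 1 :=
      pair_le_one _ _ _ 3 (by decide) (by decide) (fun h =>
        Finset.disjoint_left.mp (hA.1.2 1 2 (by decide)) h m3)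
    have q1 : 3 ≤ fAdd (A 0 ∩ {0, 1, 2}).card (A 0 ∩ ∅).card := by
      have := Nat.mul_le_mul (Nat.mul_le_mul
        (le_refl (fAdd (A 0 ∩ {0, 1, 2}).card (A 0 ∩ ∅).card)) p1) u1
      omega
    have b2 : fAdd (A' 0 ∩ {0, 1, 2}).card (A' 0 ∩ ∅).card ≤ 3 := by
      have := card_inter_le_right (A' 0) {0, 1, 2}
      simpa [fAdd] using this
    have p2 : 2 ≤ fPair (A' 1 ∩ {0, 3}).card (A' 1 ∩ {4}).card := by
      by_contra hc
      have := Nat.mul_le_mul b2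
        (by omega : fPair (A' 1 ∩ {0, 3}).card (A' 1 ∩ {4}).card ≤ 1)
      omega
    have c := pair_conflict (A' 0) (A' 1) _ _ (hA'.1.2 0 1 (by decide)) p2 (by decide)
    have d := card_inter_le_of_forall (A' 0) {0, 1, 2} {1, 2} (by
      intro t ht hz
      apply c
      revert t; decide)
    have e : fAdd (A' 0 ∩ {0, 1, 2}).card (A' 0 ∩ ∅).card ≤ 2 := by
      simpa [fAdd] using d
    omega

theorem partC : ∃ (M : Finset ℕ) (n : ℕ) (v : Fin n → Finset ℕ → ℝ) (i : Fin n)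
        (vfalse : Finset ℕ → ℝ),
      (∀ j, BinarySubadditiveOn M (v j)) ∧ BinarySubadditiveOn M vfalse ∧
      ∀ A A' : Fin n → Finset ℕ,
        IsMNW n M v A → IsMNW n M (Function.update v i vfalse) A' →
        v i (A i) < v i (A' i) := by
  refine ⟨{0, 1, 2, 3, 4, 5}, 2,
    ![cval {0, 1} {2, 3, 4} fAdd, cval {0, 1} {5} fPair], 0, cval {0, 1} {2, 3, 4} fLie,
    ?_, bs_lie _ _ _ (by decide) (by decide) (by decide), ?_⟩
  · intro j
    fin_cases j
    · exact bs_add _ _ _ (by decide)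
    · exact bs_pair _ _ _ (by decide) (by decide) (by decide)
  · intro A A' hA hA'
    have h1 := hA.le ![{2, 3, 4}, {0, 1}] (by unfold IsAlloc; decide) 6 (by norm_num) (by
      simp only [NashProd, Fin.prod_univ_two]
      change cval _ _ _ _ * cval _ _ _ _ = _
      unfold cval
      exact_mod_cast (by decide))
    have h2 := hA'.le ![{0, 1, 2, 3, 4}, {5}] (by unfold IsAlloc; decide) 3 (by norm_num) (by
      simp only [NashProd, Fin.prod_univ_two]
      rw [Function.update_self, Function.update_of_ne (by decide)]
      change cval _ _ _ _ * cval _ _ _ _ = _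
      unfold cval
      exact_mod_cast (by decide))
    simp only [NashProd, Fin.prod_univ_two] at h1 h2
    rw [Function.update_self, Function.update_of_ne (by decide)] at h2
    change ((6 : ℕ) : ℝ) ≤ cval _ _ _ _ * cval _ _ _ _ at h1
    change ((3 : ℕ) : ℝ) ≤ cval _ _ _ _ * cval _ _ _ _ at h2
    change cval _ _ _ _ < cval _ _ _ _
    unfold cval at h1 h2 ⊢
    norm_cast at h1 h2 ⊢
    have x1 := card_inter_le_right (A 0) {0, 1}
    have x2 := card_inter_le_right (A 0) {2, 3, 4}
    have y1 := card_inter_le_right (A' 0) {0, 1}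
    have y2 := card_inter_le_right (A' 0) {2, 3, 4}
    rw [show ({0, 1} : Finset ℕ).card = 2 from rfl] at x1 y1
    rw [show ({2, 3, 4} : Finset ℕ).card = 3 from rfl] at x2 y2
    have p1 : 2 ≤ fPair (A 1 ∩ {0, 1}).card (A 1 ∩ {5}).card := by
      by_contra hc
      have := Nat.mul_le_mul
        (by unfold fAdd; omega : fAdd (A 0 ∩ {0, 1}).card (A 0 ∩ {2, 3, 4}).card ≤ 5)
        (by omega : fPair (A 1 ∩ {0, 1}).card (A 1 ∩ {5}).card ≤ 1)
      omega
    have c := pair_conflict (A 0) (A 1) _ _ (hA.1.2 0 1 (by decide)) p1 (by decide)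
    have d : (A 0 ∩ {0, 1}).card ≤ (∅ : Finset ℕ).card :=
      card_inter_le_of_forall (A 0) {0, 1} ∅ (fun t ht _ => c t ht)
    rw [Finset.card_empty] at d
    have p2 : fPair (A' 1 ∩ {0, 1}).card (A' 1 ∩ {5}).card ≤ 1 := by
      by_contra hc
      have c := pair_conflict (A' 0) (A' 1) _ _ (hA'.1.2 0 1 (by decide))
        (by omega : 2 ≤ fPair (A' 1 ∩ {0, 1}).card (A' 1 ∩ {5}).card) (by decide)
      have d : (A' 0 ∩ {0, 1}).card ≤ (∅ : Finset ℕ).card :=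
        card_inter_le_of_forall (A' 0) {0, 1} ∅ (fun t ht _ => c t ht)
      rw [Finset.card_empty] at d
      have e : fLie (A' 0 ∩ {0, 1}).card (A' 0 ∩ {2, 3, 4}).card ≤ 1 := by
        unfold fLie; split_ifs <;> omega
      have := Nat.mul_le_mul e (fPair_le (A' 1 ∩ {0, 1}).card (A' 1 ∩ {5}).card)
      omega
    have q : 3 ≤ fLie (A' 0 ∩ {0, 1}).card (A' 0 ∩ {2, 3, 4}).card := by
      have := Nat.mul_le_mul
        (le_refl (fLie (A' 0 ∩ {0, 1}).card (A' 0 ∩ {2, 3, 4}).card)) p2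
      omega
    unfold fLie at q
    unfold fAdd
    split_ifs at q <;> omega

/-- Under binary subadditive valuations, MNW fails (a) resource-monotonicity,
(b) population-monotonicity, and (c) strategyproofness, regardless of tie-breaking. -/
theorem mnwFailsSubadditive :
    (∃ (M : Finset ℕ) (gstar : ℕ) (n : ℕ) (v : Fin n → Finset ℕ → ℝ) (i : Fin n),
      gstar ∈ M ∧ (∀ j, BinarySubadditiveOn M (v j)) ∧
      ∀ A A' : Fin n → Finset ℕ,
        IsMNW n (M.erase gstar) v A → IsMNW n M v A' →
        v i (A' i) < v i (A i)) ∧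
    (∃ (M : Finset ℕ) (n : ℕ) (v : Fin (n + 1) → Finset ℕ → ℝ) (i : Fin n),
      (∀ j, BinarySubadditiveOn M (v j)) ∧
      ∀ (A : Fin n → Finset ℕ) (A' : Fin (n + 1) → Finset ℕ),
        IsMNW n M (fun j => v j.castSucc) A → IsMNW (n + 1) M v A' →
        v i.castSucc (A i) < v i.castSucc (A' i.castSucc)) ∧
    (∃ (M : Finset ℕ) (n : ℕ) (v : Fin n → Finset ℕ → ℝ) (i : Fin n)
        (vfalse : Finset ℕ → ℝ),
      (∀ j, BinarySubadditiveOn M (v j)) ∧ BinarySubadditiveOn M vfalse ∧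
      ∀ A A' : Fin n → Finset ℕ,
        IsMNW n M v A → IsMNW n M (Function.update v i vfalse) A' →
        v i (A i) < v i (A' i)) := by
  exact ⟨partA, partB, partC⟩
end

section
/- In the unweighted setting, under restricted additive valuations, MNW is not resource-monotone regardless of tie-breaking: there exist a finite set of goods G, a good g* ∈ G, agents whose valuations form a restricted additive profile on G, and an agent i, such that for every MNW allocation A of the instance with goods G ∖ {g*} and every MNW allocation A' of the instance with goods G, we have v_i(A'_i) < v_i(A_i). -/
open Finset

/-- Values of single goods. Good `0` (value 1) is liked only by agent `1`, good `1` (value 3)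
by both agents, good `2` (value 2) only by agent `0`. -/
def exW (i : Fin 2) (g : ℕ) : ℝ :=
  if g = 0 then (if i = 1 then 1 else 0)
  else if g = 1 then 3
  else if g = 2 then (if i = 0 then 2 else 0) else 0

lemma exW_nonneg (i : Fin 2) (g : ℕ) : 0 ≤ exW i g := by
  unfold exW
  split_ifs <;> norm_num

lemma exSum_le (i : Fin 2) {S T : Finset ℕ} (h : S ⊆ T) :
    ∑ g ∈ S, exW i g ≤ ∑ g ∈ T, exW i g :=
  Finset.sum_le_sum_of_subset_of_nonneg h fun g _ _ => exW_nonneg i g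

lemma exSum_nonneg (i : Fin 2) (S : Finset ℕ) : 0 ≤ ∑ g ∈ S, exW i g :=
  Finset.sum_nonneg fun g _ => exW_nonneg i g

/-- Under restricted additive valuations, MNW is not resource-monotone regardless of
tie-breaking. -/
theorem mnwNotResourceMonotoneRestrictedAdditive :
    ∃ (M : Finset ℕ) (gstar : ℕ) (n : ℕ) (v : Fin n → Finset ℕ → ℝ) (i : Fin n),
      gstar ∈ M ∧ RestrictedAdditive n M v ∧
      ∀ A A' : Fin n → Finset ℕ,
        IsMNW n (M.erase gstar) v A → IsMNW n M v A' →
        v i (A' i) < v i (A i) := by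
  refine ⟨{0, 1, 2}, 2, 2, fun i S => ∑ g ∈ S, exW i g, 0, by simp, ⟨?_, ?_⟩, ?_⟩
  · intro i
    exact ⟨fun g _ => by simpa using exW_nonneg i g, fun S _ => by simp⟩
  · refine ⟨fun g => if g = 0 then 1 else if g = 1 then 3 else 2, ?_, ?_⟩
    · intro g _
      dsimp only
      split_ifs <;> norm_num
    · intro i g hg
      simp only [Finset.mem_insert, Finset.mem_singleton] at hg
      rcases hg with rfl | rfl | rfl <;> fin_cases i <;> simp [exW]
  · rintro A A' ⟨hA, hA1, -⟩ ⟨hA', hA1', -⟩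
    have hB : IsAlloc 2 (({0, 1, 2} : Finset ℕ).erase 2) ![{1}, {0}] := by
      unfold IsAlloc; decide
    have hB' : IsAlloc 2 ({0, 1, 2} : Finset ℕ) ![{2}, {0, 1}] := by
      unfold IsAlloc; decide
    have eB : NashProd 2 (fun i S => ∑ g ∈ S, exW i g) ![{1}, {0}] = 3 := by
      simp [NashProd, Fin.prod_univ_two, exW]
    have eB' : NashProd 2 (fun i S => ∑ g ∈ S, exW i g) ![{2}, {0, 1}] = 8 := by
      simp [NashProd, Fin.prod_univ_two, exW]
      norm_num
    have h1 := hA1 ⟨_, hB, by rw [eB]; norm_num⟩ _ hB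
    have h2 := hA1' ⟨_, hB', by rw [eB']; norm_num⟩ _ hB'
    rw [eB] at h1
    rw [eB'] at h2
    simp only [NashProd, Fin.prod_univ_two] at h1 h2
    have k1 : 1 ∈ A 0 := by
      by_contra hn
      have hs : A 0 ⊆ {0} := by
        intro g hg
        have := hA.1 0 hg
        simp only [Finset.mem_erase, Finset.mem_insert, Finset.mem_singleton] at this ⊢
        rcases this with ⟨h, rfl | rfl | rfl⟩
        · rfl
        · exact absurd hg hn
        · exact absurd rfl h
      have hle := exSum_le 0 hs
      have e : ∑ g ∈ ({0} : Finset ℕ), exW 0 g = 0 := by simp [exW]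
      have h0 : ∑ g ∈ A 0, exW 0 g = 0 := le_antisymm (e ▸ hle) (exSum_nonneg _ _)
      rw [h0] at h1
      norm_num at h1
    have k2 : 1 ∉ A' 0 := by
      intro hn
      have hn1 : 1 ∉ A' 1 := Finset.disjoint_left.1 (hA'.2 0 1 (by decide)) hn
      have hs : A' 1 ⊆ {0, 2} := by
        intro g hg
        have := hA'.1 1 hg
        simp only [Finset.mem_insert, Finset.mem_singleton] at this ⊢
        rcases this with rfl | rfl | rfl
        · simp
        · exact absurd hg hn1
        · simp
      have l1 := exSum_le 1 hs
      have l0 := exSum_le 0 (hA'.1 0)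
      have e1 : ∑ g ∈ ({0, 2} : Finset ℕ), exW 1 g = 1 := by simp [exW]
      have e0 : ∑ g ∈ ({0, 1, 2} : Finset ℕ), exW 0 g = 5 := by
        simp [exW]
        norm_num
      rw [e1] at l1
      rw [e0] at l0
      nlinarith [exSum_nonneg 0 (A' 0), exSum_nonneg 1 (A' 1)]
    have m1 := exSum_le 0 (Finset.singleton_subset_iff.2 k1)
    have hs : A' 0 ⊆ {0, 2} := by
      intro g hg
      have := hA'.1 0 hg
      simp only [Finset.mem_insert, Finset.mem_singleton] at this ⊢
      rcases this with rfl | rfl | rfl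
      · simp
      · exact absurd hg k2
      · simp
    have m2 := exSum_le 0 hs
    have e1 : ∑ g ∈ ({1} : Finset ℕ), exW 0 g = 3 := by simp [exW]
    have e2 : ∑ g ∈ ({0, 2} : Finset ℕ), exW 0 g = 2 := by simp [exW]
    rw [e1] at m1
    rw [e2] at m2
    show ∑ g ∈ A' 0, exW 0 g < ∑ g ∈ A 0, exW 0 g
    linarith
end

section
/- In the unweighted setting, under restricted additive valuations, MNW is not population-monotone regardless of tie-breaking: there exist a finite set of goods G, agents N whose valuations together with the valuation of one additional agent form a restricted additive profile on G, and an agent i ∈ N, such that for every MNW allocation A of the instance with agent set N and every MNW allocation A' of the instance with agent set N plus the additional agent (the agents in N keeping their valuations), we have v_i(A'_i) > v_i(A_i). -/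
open Finset

/-- Additive valuation on goods `0, 1, 2` with values `a, b, c`. -/
noncomputable def val3 (a b c : ℝ) (S : Finset ℕ) : ℝ :=
  (if 0 ∈ S then a else 0) + (if 1 ∈ S then b else 0) + (if 2 ∈ S then c else 0)

lemma val3_additive (a b c : ℝ) (ha : 0 ≤ a) (hb : 0 ≤ b) (hc : 0 ≤ c) :
    AdditiveOn {0, 1, 2} (val3 a b c) := by
  refine ⟨fun g _ => ?_, fun S hS => ?_⟩
  · unfold val3; positivity
  · have h1 : ∀ g, val3 a b c {g} = (if g = 0 then a else 0) + (if g = 1 then b else 0)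
        + (if g = 2 then c else 0) := by
      intro g; simp [val3, eq_comm]
    simp only [h1, Finset.sum_add_distrib, Finset.sum_ite_eq']
    rfl

/-- Under restricted additive valuations, MNW is not population-monotone regardless of
tie-breaking. -/
theorem mnwNotPopulationMonotoneRestrictedAdditive :
    ∃ (M : Finset ℕ) (n : ℕ) (v : Fin (n + 1) → Finset ℕ → ℝ) (i : Fin n),
      RestrictedAdditive (n + 1) M v ∧
      ∀ (A : Fin n → Finset ℕ) (A' : Fin (n + 1) → Finset ℕ),
        IsMNW n M (fun j => v j.castSucc) A → IsMNW (n + 1) M v A' →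
        v i.castSucc (A i) < v i.castSucc (A' i.castSucc) := by
  refine ⟨{0, 1, 2}, 2, ![val3 1 0 3, val3 0 2 3, val3 0 2 0], 1, ⟨?_, ?_⟩, ?_⟩
  · intro i
    fin_cases i <;> exact val3_additive _ _ _ (by norm_num) (by norm_num) (by norm_num)
  · refine ⟨fun g => g + 1, fun g _ => by positivity, ?_⟩
    intro i g hg
    simp only [Finset.mem_insert, Finset.mem_singleton] at hg
    fin_cases i <;> rcases hg with rfl | rfl | rfl <;> norm_num [val3]
  · rintro A A' ⟨⟨-, hA⟩, hA2, -⟩ ⟨⟨-, hB⟩, hB2, -⟩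
    -- reference allocations
    have e1 : IsAlloc 2 {0, 1, 2} ![{0, 2}, {1}] := by
      refine ⟨fun i => ?_, fun i j => ?_⟩
      · fin_cases i <;> decide
      · fin_cases i <;> fin_cases j <;> simp
    have e2 : IsAlloc 3 {0, 1, 2} ![{0}, {2}, {1}] := by
      refine ⟨fun i => ?_, fun i j => ?_⟩
      · fin_cases i <;> decide
      · fin_cases i <;> fin_cases j <;> simp
    have p1 : NashProd 2 (fun j => (![val3 1 0 3, val3 0 2 3, val3 0 2 0] :
        Fin 3 → Finset ℕ → ℝ) j.castSucc) ![{0, 2}, {1}] = 8 := by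
      norm_num [NashProd, Fin.prod_univ_succ, val3]
    have p2 : NashProd 3 ![val3 1 0 3, val3 0 2 3, val3 0 2 0] ![{0}, {2}, {1}] = 6 := by
      norm_num [NashProd, Fin.prod_univ_succ, val3]
    have q1 := hA2 ⟨_, e1, by rw [p1]; norm_num⟩ _ e1
    have q2 := hB2 ⟨_, e2, by rw [p2]; norm_num⟩ _ e2
    rw [p1] at q1
    rw [p2] at q2
    have d1 : 2 ∈ A 0 → 2 ∉ A 1 := fun h => Finset.disjoint_left.1 (hA 0 1 (by decide)) h
    have d2 : 1 ∈ A' 1 → 1 ∉ A' 2 := fun h => Finset.disjoint_left.1 (hB 1 2 (by decide)) h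
    have r1 : 8 ≤ val3 1 0 3 (A 0) * val3 0 2 3 (A 1) := by
      simpa [NashProd, Fin.prod_univ_two] using q1
    have r2 : 6 ≤ val3 1 0 3 (A' 0) * val3 0 2 3 (A' 1) * val3 0 2 0 (A' 2) := by
      simpa [NashProd, Fin.prod_univ_three] using q2
    change val3 0 2 3 (A 1) < val3 0 2 3 (A' 1)
    have s1 : val3 0 2 3 (A 1) ≤ 2 := by
      by_cases h : 2 ∈ A 1
      · have h0 : 2 ∉ A 0 := fun h' => d1 h' h
        exfalso
        simp only [val3, h, h0, if_true, if_false] at r1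
        split_ifs at r1 <;> norm_num at r1
      · simp only [val3, h, if_false]
        split_ifs <;> norm_num
    have s2 : 3 ≤ val3 0 2 3 (A' 1) := by
      by_cases h : 2 ∈ A' 1
      · simp only [val3, h, if_true]
        split_ifs <;> norm_num
      · exfalso
        by_cases h1 : 1 ∈ A' 1
        · have h2 := d2 h1
          have : val3 0 2 0 (A' 2) = 0 := by simp [val3, h2]
          rw [this] at r2; norm_num at r2
        · have : val3 0 2 3 (A' 1) = 0 := by simp [val3, h, h1]
          rw [this] at r2; norm_num at r2
    linarith
end

section
/- In the unweighted setting, under restricted additive valuations, MNW is not strategyproof regardless of tie-breaking: there exist a finite set of goods G, a restricted additive profile (v_1,…,v_n) on G, an agent i, and an additive valuation v'_i such that the profile obtained by replacing v_i with v'_i is also restricted additive, and for every MNW allocation A of the instance with the true profile and every MNW allocation A' of the instance with the misreported profile, we have v_i(A'_i) > v_i(A_i) (utilities measured by agent i's true valuation v_i). -/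
open Finset

/-- Per-good weights of the form: value `a` for good `0`, value `2` for every other good. -/
def wt (a g : ℕ) : ℕ := if g = 0 then a else 2

/-- The additive valuation induced by `wt a`. -/
def wval (a : ℕ) (S : Finset ℕ) : ℝ := ((∑ g ∈ S, wt a g : ℕ) : ℝ)

theorem wval_additive (M : Finset ℕ) (a : ℕ) : AdditiveOn M (wval a) := by
  refine ⟨fun g _ => by unfold wval; positivity, fun S _ => ?_⟩
  simp [wval]

theorem wval_restricted (M : Finset ℕ) (a : ℕ) :
    RestrictedAdditive 2 M ![wval a, wval 0] := by
  refine ⟨fun i => ?_, fun g => (wt a g : ℝ), fun g _ => by positivity, fun i g _ => ?_⟩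
  · fin_cases i <;> exact wval_additive M _
  · fin_cases i
    · right; simp [wval]
    · by_cases h : g = 0
      · left; simp [wval, wt, h]
      · right; simp [wval, wt, h]

/-- An MNW allocation has Nash product at least that of the allocation `(S, T)`. -/
theorem mnw_lower (a : ℕ) (A : Fin 2 → Finset ℕ)
    (hA : IsMNW 2 {0, 1, 2} ![wval a, wval 0] A) (S T : Finset ℕ)
    (hS : S ⊆ {0, 1, 2}) (hT : T ⊆ {0, 1, 2}) (hd : Disjoint S T)
    (hpos : 0 < (∑ g ∈ S, wt a g) * (∑ g ∈ T, wt 0 g)) :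
    (∑ g ∈ S, wt a g) * (∑ g ∈ T, wt 0 g) ≤
      (∑ g ∈ A 0, wt a g) * (∑ g ∈ A 1, wt 0 g) := by
  have hB : IsAlloc 2 {0, 1, 2} ![S, T] := by
    refine ⟨fun i => ?_, fun i j hij => ?_⟩
    · fin_cases i
      · exact hS
      · exact hT
    · fin_cases i <;> fin_cases j
      · exact absurd rfl hij
      · exact hd
      · exact hd.symm
      · exact absurd rfl hij
  have key : ∀ B : Fin 2 → Finset ℕ, NashProd 2 ![wval a, wval 0] B =
      (((∑ g ∈ B 0, wt a g) * (∑ g ∈ B 1, wt 0 g) : ℕ) : ℝ) := by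
    intro B
    rw [Nat.cast_mul]
    exact Fin.prod_univ_two _
  have h1 := hA.2.1 ⟨_, hB, by rw [key]; exact Nat.cast_ne_zero.mpr hpos.ne'⟩ _ hB
  rw [key, key] at h1
  exact Nat.cast_le.mp h1

theorem true_bound : ∀ S ∈ ({0, 1, 2} : Finset ℕ).powerset,
    ∀ T ∈ ({0, 1, 2} : Finset ℕ).powerset, Disjoint S T →
    16 ≤ (∑ g ∈ S, wt 4 g) * (∑ g ∈ T, wt 0 g) → ∑ g ∈ S, wt 4 g ≤ 4 := by
  decide +kernel

theorem false_bound : ∀ S ∈ ({0, 1, 2} : Finset ℕ).powerset,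
    ∀ T ∈ ({0, 1, 2} : Finset ℕ).powerset, Disjoint S T →
    6 ≤ (∑ g ∈ S, wt 1 g) * (∑ g ∈ T, wt 0 g) → 6 ≤ ∑ g ∈ S, wt 4 g := by
  decide +kernel

/-- Under restricted additive valuations, MNW is not strategyproof regardless of
tie-breaking. -/
theorem mnwNotStrategyproofRestrictedAdditive :
    ∃ (M : Finset ℕ) (n : ℕ) (v : Fin n → Finset ℕ → ℝ) (i : Fin n)
      (vfalse : Finset ℕ → ℝ),
      RestrictedAdditive n M v ∧ AdditiveOn M vfalse ∧
      RestrictedAdditive n M (Function.update v i vfalse) ∧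
      ∀ A A' : Fin n → Finset ℕ,
        IsMNW n M v A → IsMNW n M (Function.update v i vfalse) A' →
        v i (A i) < v i (A' i) := by
  have hu : Function.update ![wval 4, wval 0] 0 (wval 1) = ![wval 1, wval 0] := by
    funext i
    fin_cases i <;> simp
  refine ⟨{0, 1, 2}, 2, ![wval 4, wval 0], 0, wval 1, wval_restricted _ _,
    wval_additive _ _, ?_, ?_⟩
  · rw [hu]; exact wval_restricted _ _
  · intro A A' hA hA'
    rw [hu] at hA'
    have h1 := mnw_lower 4 A hA {0} {1, 2} (by decide) (by decide) (by decide) (by decide)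
    have h2 := mnw_lower 1 A' hA' {0, 1} {2} (by decide) (by decide) (by decide) (by decide)
    have b1 := true_bound _ (mem_powerset.mpr (hA.1.1 0)) _ (mem_powerset.mpr (hA.1.1 1))
      (hA.1.2 0 1 (by decide)) (le_trans (by decide) h1)
    have b2 := false_bound _ (mem_powerset.mpr (hA'.1.1 0)) _ (mem_powerset.mpr (hA'.1.1 1))
      (hA'.1.2 0 1 (by decide)) (le_trans (by decide) h2)
    change wval 4 (A 0) < wval 4 (A' 0)
    unfold wval
    exact Nat.cast_lt.mpr (by omega)
end
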